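/- Exact values for the R_y family: for every θ ∈ (0, π), the two-qubit state ρ_θ = |ψ_θ⟩⟨ψ_θ| with |ψ_θ⟩ = cos(θ/2)|00⟩ + sin(θ/2)|11⟩ satisfies C(ρ_θ) = |sin θ| + |cos θ| − 1 and Γ(ρ_θ) = |sin θ| + |cos θ|; in particular Γ(ρ_θ) − 1 = C(ρ_θ), so the tightness ratio κ(ρ_θ) = (Γ(ρ_θ) − 1)/C(ρ_θ) equals 1 whenever C(ρ_θ) > 0 (i.e. θ ≠ π/2). -/

import Mathlib

open Matrix Kronecker Finset
open scoped ComplexOrder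

noncomputable section

def PX : Matrix (Fin 2) (Fin 2) ℂ := !![0, 1; 1, 0]
def PY : Matrix (Fin 2) (Fin 2) ℂ := !![0, -Complex.I; Complex.I, 0]
def PZ : Matrix (Fin 2) (Fin 2) ℂ := !![1, 0; 0, -1]

/-- The single-qubit phase-point operator `A_{(q,p)}`. -/
def A1 (a : ZMod 2 × ZMod 2) : Matrix (Fin 2) (Fin 2) ℂ :=
  (1 / 2 : ℂ) • ((1 : Matrix (Fin 2) (Fin 2) ℂ)
    + ((-1 : ℂ) ^ a.2.val) • PX
    + ((-1 : ℂ) ^ (a.1.val + a.2.val)) • PY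
    + ((-1 : ℂ) ^ a.1.val) • PZ)

def pauli : Fin 4 → Matrix (Fin 2) (Fin 2) ℂ := ![1, PX, PY, PZ]

/-- A density matrix: positive semidefinite with unit trace. -/
def IsDensity {d : ℕ} (ρ : Matrix (Fin d) (Fin d) ℂ) : Prop :=
  ρ.PosSemidef ∧ ρ.trace = 1

/-- Kronecker product of 2×2 matrices as a 4×4 matrix. -/
def kron2 (M N : Matrix (Fin 2) (Fin 2) ℂ) : Matrix (Fin 4) (Fin 4) ℂ :=
  Matrix.reindex (finProdFinEquiv.trans (finCongr (by norm_num)))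
    (finProdFinEquiv.trans (finCongr (by norm_num))) (M ⊗ₖ N)

/-- The two-qubit phase-point operator `A_α = A_{α₁} ⊗ A_{α₂}`. -/
def A2 (α : (ZMod 2 × ZMod 2) × (ZMod 2 × ZMod 2)) : Matrix (Fin 4) (Fin 4) ℂ :=
  kron2 (A1 α.1) (A1 α.2)

/-- The two-qubit Pauli group `P₂`. -/
def Pauli2 : Set (Matrix (Fin 4) (Fin 4) ℂ) :=
  { M | ∃ (k : Fin 4) (P Q : Fin 4), M = Complex.I ^ (k : ℕ) • kron2 (pauli P) (pauli Q) }

/-- `S` is an abelian subgroup of `P₂` with `|S| = 4` and `-I ∉ S`. -/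
def IsStabGroup2 (S : Finset (Matrix (Fin 4) (Fin 4) ℂ)) : Prop :=
  (∀ g ∈ S, g ∈ Pauli2) ∧ (1 : Matrix (Fin 4) (Fin 4) ℂ) ∈ S ∧
  (∀ g ∈ S, ∀ h ∈ S, g * h ∈ S ∧ g * h = h * g) ∧
  S.card = 4 ∧ (-1 : Matrix (Fin 4) (Fin 4) ℂ) ∉ S

/-- The pure two-qubit stabilizer states. -/
def Stab2 : Set (Matrix (Fin 4) (Fin 4) ℂ) :=
  { σ | ∃ S : Finset (Matrix (Fin 4) (Fin 4) ℂ),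
      IsStabGroup2 S ∧ σ = (4 : ℂ)⁻¹ • ∑ g ∈ S, g }

/-- Two-qubit discrete Wigner function (of any 4×4 matrix). -/
def W2 (ρ : Matrix (Fin 4) (Fin 4) ℂ) (α : (ZMod 2 × ZMod 2) × (ZMod 2 × ZMod 2)) : ℝ :=
  ((4 : ℂ)⁻¹ * (ρ * A2 α).trace).re

/-- Two-qubit free Wigner polytope. -/
def WFree2 : Set (((ZMod 2 × ZMod 2) × (ZMod 2 × ZMod 2)) → ℝ) :=
  convexHull ℝ { w | ∃ σ ∈ Stab2, w = W2 σ }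

/-- Two-qubit Wigner distance `C(ρ)`. -/
def C2 (ρ : Matrix (Fin 4) (Fin 4) ℂ) : ℝ :=
  sInf { d | ∃ f ∈ WFree2, d = ∑ α, |W2 ρ α - f α| }

/-- Two-qubit stabilizer extent `Γ(ρ)`. -/
def Gam2 (ρ : Matrix (Fin 4) (Fin 4) ℂ) : ℝ :=
  sInf { t | ∃ (k : ℕ) (a : Fin k → ℝ) (s : Fin k → Matrix (Fin 4) (Fin 4) ℂ),
      (∀ i, s i ∈ Stab2) ∧ ρ = ∑ i, a i • s i ∧ t = ∑ i, |a i| }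

/-- Rank-one projection `|ψ⟩⟨ψ|`. -/
def proj (ψ : Fin 4 → ℂ) : Matrix (Fin 4) (Fin 4) ℂ :=
  Matrix.vecMulVec ψ fun j => (starRingEnd ℂ) (ψ j)

/-- The basis vector `|00⟩`. -/
def e0 : Fin 4 → ℂ := fun i => if i = 0 then 1 else 0

/-- The basis vector `|11⟩`. -/
def e3 : Fin 4 → ℂ := fun i => if i = 3 then 1 else 0

/-- `|ψ_θ⟩ = cos(θ/2)|00⟩ + sin(θ/2)|11⟩` (the R_y family). -/
def psiRy (θ : ℝ) : Fin 4 → ℂ := fun i =>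
  if i = 0 then ((Real.cos (θ / 2) : ℝ) : ℂ)
  else if i = 3 then ((Real.sin (θ / 2) : ℝ) : ℂ) else 0

/-- `|ψ_θ⟩ = cos(θ/2)|00⟩ − i sin(θ/2)|11⟩` (the R_x family). -/
def psiRx (θ : ℝ) : Fin 4 → ℂ := fun i =>
  if i = 0 then ((Real.cos (θ / 2) : ℝ) : ℂ)
  else if i = 3 then -Complex.I * ((Real.sin (θ / 2) : ℝ) : ℂ) else 0

/-- `|Φ_θ⟩ = (1/√2)(|00⟩ + e^{iθ}|11⟩)` (the Bell+R_z family). -/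
def psiB (θ : ℝ) : Fin 4 → ℂ := fun i =>
  if i = 0 then (((Real.sqrt 2 : ℝ) : ℂ))⁻¹
  else if i = 3 then Complex.exp (θ * Complex.I) / ((Real.sqrt 2 : ℝ) : ℂ) else 0

/-- `|+_L⟩ = (1/√2)(|00⟩ + |11⟩)`. -/
def pPlus : Fin 4 → ℂ := fun i =>
  if i = 0 then (((Real.sqrt 2 : ℝ) : ℂ))⁻¹
  else if i = 3 then (((Real.sqrt 2 : ℝ) : ℂ))⁻¹ else 0

/-- `|−_L⟩ = (1/√2)(|00⟩ − |11⟩)`. -/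
def pMinus : Fin 4 → ℂ := fun i =>
  if i = 0 then (((Real.sqrt 2 : ℝ) : ℂ))⁻¹
  else if i = 3 then -(((Real.sqrt 2 : ℝ) : ℂ))⁻¹ else 0

/-- The Hermitian two-qubit Pauli operator `pauli a ⊗ pauli b`. -/
def pauliPair (a b : Fin 4) : Matrix (Fin 4) (Fin 4) ℂ := kron2 (pauli a) (pauli b)

lemma kron2_mul (A B C D : Matrix (Fin 2) (Fin 2) ℂ) :
    kron2 A B * kron2 C D = kron2 (A * C) (B * D) := by
  simp only [kron2, Matrix.reindex_apply, Matrix.submatrix_mul_equiv, Matrix.mul_kronecker_mul]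

lemma trace_kron2 (A B : Matrix (Fin 2) (Fin 2) ℂ) :
    (kron2 A B).trace = A.trace * B.trace := by
  rw [← Matrix.trace_kronecker]
  exact Equiv.sum_comp _ (fun i => (A ⊗ₖ B) i i)

lemma kron2_one_one : kron2 1 1 = 1 := by
  simp [kron2]

lemma kron2_eq (A B : Matrix (Fin 2) (Fin 2) ℂ) :
    kron2 A B = !![A 0 0 * B 0 0, A 0 0 * B 0 1, A 0 1 * B 0 0, A 0 1 * B 0 1;
      A 0 0 * B 1 0, A 0 0 * B 1 1, A 0 1 * B 1 0, A 0 1 * B 1 1;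
      A 1 0 * B 0 0, A 1 0 * B 0 1, A 1 1 * B 0 0, A 1 1 * B 0 1;
      A 1 0 * B 1 0, A 1 0 * B 1 1, A 1 1 * B 1 0, A 1 1 * B 1 1] := by
  ext i j
  fin_cases i <;> fin_cases j <;> rfl

lemma pauli_mul_self (a : Fin 4) : pauli a * pauli a = 1 := by
  fin_cases a <;> ext i j <;> fin_cases i <;> fin_cases j <;>
    simp [pauli, PX, PY, PZ, Matrix.mul_apply]

lemma trace_pauli_mul (a b : Fin 4) :
    (pauli a * pauli b).trace = if a = b then 2 else 0 := by
  fin_cases a <;> fin_cases b <;>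
    simp [pauli, PX, PY, PZ, Matrix.trace_fin_two] <;> norm_num

lemma pauliPair_zero : pauliPair 0 0 = 1 := kron2_one_one

lemma pauliPair_mul_self (a b : Fin 4) : pauliPair a b * pauliPair a b = 1 := by
  rw [pauliPair, kron2_mul, pauli_mul_self, pauli_mul_self, kron2_one_one]

lemma trace_pauliPair_mul (a b c d : Fin 4) :
    (pauliPair a b * pauliPair c d).trace = if a = c ∧ b = d then 4 else 0 := by
  rw [pauliPair, pauliPair, kron2_mul, trace_kron2, trace_pauli_mul, trace_pauli_mul]
  split_ifs <;> simp_all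
  norm_num

lemma trace_pauliPair (a b : Fin 4) :
    (pauliPair a b).trace = if a = 0 ∧ b = 0 then 4 else 0 := by
  rw [← trace_pauliPair_mul, pauliPair_zero, mul_one]

lemma pauliPair_mem (a b : Fin 4) : pauliPair a b ∈ Pauli2 := ⟨0, a, b, by simp [pauliPair]⟩

lemma neg_pauliPair_mem (a b : Fin 4) : -pauliPair a b ∈ Pauli2 :=
  ⟨2, a, b, by simp [pauliPair]⟩

lemma IsStabGroup2.eq_or_eq_neg {S : Finset (Matrix (Fin 4) (Fin 4) ℂ)} (hS : IsStabGroup2 S)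
    (a b : Fin 4) {g : Matrix (Fin 4) (Fin 4) ℂ} (hg : g ∈ S)
    (h : (g * pauliPair a b).trace ≠ 0) : g = pauliPair a b ∨ g = -pauliPair a b := by
  obtain ⟨hP, h1, hmul, hc, hneg⟩ := hS
  obtain ⟨k, c, d, rfl⟩ := hP g hg
  change Complex.I ^ (k : ℕ) • pauliPair c d ∈ S at hg
  change (Complex.I ^ (k : ℕ) • pauliPair c d * pauliPair a b).trace ≠ 0 at h
  change Complex.I ^ (k : ℕ) • pauliPair c d = _ ∨ Complex.I ^ (k : ℕ) • pauliPair c d = _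
  have hcd : c = a ∧ d = b := by
    by_contra hne
    exact h (by rw [smul_mul_assoc, trace_smul, trace_pauliPair_mul, if_neg hne, smul_zero])
  obtain ⟨rfl, rfl⟩ := hcd
  have hsq := (hmul _ hg _ hg).1
  rw [smul_mul_smul_comm, pauliPair_mul_self] at hsq
  fin_cases k
  · simp
  · exact absurd (by simpa using hsq) hneg
  · simp
  · exact absurd (by simpa [← mul_pow] using hsq) hneg

/-- The Pauli expectation values of a stabilizer state are `0` or `±1`, and a nonzero value
is witnessed in the stabilizer group. -/
lemma IsStabGroup2.expectation {S : Finset (Matrix (Fin 4) (Fin 4) ℂ)} (hS : IsStabGroup2 S)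
    (a b : Fin 4) :
    (((4 : ℂ)⁻¹ • ∑ g ∈ S, g) * pauliPair a b).trace = 0 ∨
      |((((4 : ℂ)⁻¹ • ∑ g ∈ S, g) * pauliPair a b).trace).re| = 1 ∧
        (pauliPair a b ∈ S ∨ -pauliPair a b ∈ S) := by
  have hexp : (((4 : ℂ)⁻¹ • ∑ g ∈ S, g) * pauliPair a b).trace
      = (4 : ℂ)⁻¹ * ∑ g ∈ S, (g * pauliPair a b).trace := by
    rw [smul_mul_assoc, trace_smul, Finset.sum_mul, trace_sum, smul_eq_mul]
  have hnot : pauliPair a b ∈ S → -pauliPair a b ∉ S := by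
    intro h h'
    have := (hS.2.2.1 _ h _ h').1
    rw [mul_neg, pauliPair_mul_self] at this
    exact hS.2.2.2.2 this
  rw [hexp]
  by_cases hp : pauliPair a b ∈ S
  · right
    refine ⟨?_, Or.inl hp⟩
    rw [Finset.sum_eq_single_of_mem _ hp, pauliPair_mul_self]
    · norm_num [Matrix.trace_one]
    · intro g hg hne
      by_contra h
      rcases hS.eq_or_eq_neg a b hg h with rfl | rfl
      · exact hne rfl
      · exact hnot hp hg
  · by_cases hn : -pauliPair a b ∈ S
    · right
      refine ⟨?_, Or.inr hn⟩
      rw [Finset.sum_eq_single_of_mem _ hn, neg_mul, pauliPair_mul_self]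
      · norm_num [Matrix.trace_one]
      · intro g hg hne
        by_contra h
        rcases hS.eq_or_eq_neg a b hg h with rfl | rfl
        · exact hp hg
        · exact hne rfl
    · left
      rw [Finset.sum_eq_zero, mul_zero]
      intro g hg
      by_contra h
      rcases hS.eq_or_eq_neg a b hg h with rfl | rfl
      · exact hp hg
      · exact hn hg

lemma stab2_abs_add_abs_le {σ : Matrix (Fin 4) (Fin 4) ℂ} (hσ : σ ∈ Stab2) (a b c d : Fin 4)
    (hanti : pauliPair a b * pauliPair c d = -(pauliPair c d * pauliPair a b)) :
    |(σ * pauliPair a b).trace.re| + |(σ * pauliPair c d).trace.re| ≤ 1 := by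
  obtain ⟨S, hS, rfl⟩ := hσ
  rcases hS.expectation a b with h | ⟨h, hm⟩
  · rcases hS.expectation c d with h' | ⟨h', -⟩
    · rw [h, h']
      simp
    · simp only [h, h']; simp
  · rcases hS.expectation c d with h' | ⟨h', hm'⟩
    · simp only [h, h']; simp
    · exfalso
      have hcomm : pauliPair a b * pauliPair c d = pauliPair c d * pauliPair a b := by
        rcases hm with hm | hm <;> rcases hm' with hm' | hm' <;>
          simpa using (hS.2.2.1 _ hm _ hm').2
      have hzero : pauliPair a b * pauliPair c d = 0 := by
        rw [← hcomm, eq_neg_iff_add_eq_zero, ← two_smul ℂ] at hanti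
        exact (smul_eq_zero.mp hanti).resolve_left two_ne_zero
      have : (pauliPair a b * (pauliPair a b * pauliPair c d)) * pauliPair c d = 1 := by
        rw [← mul_assoc, pauliPair_mul_self, one_mul, pauliPair_mul_self]
      rw [hzero, mul_zero, zero_mul] at this
      exact zero_ne_one this

/-- Two commuting independent Pauli involutions generate a stabilizer state. -/
lemma stab2_of_generators {a b : Matrix (Fin 4) (Fin 4) ℂ} (ha : a ∈ Pauli2) (hb : b ∈ Pauli2)
    (hab : a * b ∈ Pauli2) (ha2 : a * a = 1) (hb2 : b * b = 1) (hcomm : a * b = b * a)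
    (hta : a.trace = 0) (htb : b.trace = 0) (htab : (a * b).trace = 0) :
    (4 : ℂ)⁻¹ • (1 + a + b + a * b) ∈ Stab2 := by
  have ht1 : (1 : Matrix (Fin 4) (Fin 4) ℂ).trace = 4 := by simp [Matrix.trace_one]
  have h1 : ∀ m : Matrix (Fin 4) (Fin 4) ℂ, m.trace = 0 → (1 : Matrix (Fin 4) (Fin 4) ℂ) ≠ m := by
    rintro m hm rfl
    rw [ht1] at hm
    norm_num at hm
  have n1 : a ≠ b := by
    rintro rfl
    exact h1 _ htab ha2.symm
  have n2 : a ≠ a * b := fun h => h1 b htb <| by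
    calc 1 = a * a := ha2.symm
      _ = a * (a * b) := congrArg (a * ·) h
      _ = b := by rw [← mul_assoc, ha2, one_mul]
  have n3 : b ≠ a * b := fun h => h1 a hta <| by
    calc 1 = b * b := hb2.symm
      _ = (a * b) * b := congrArg (· * b) h
      _ = a := by rw [mul_assoc, hb2, mul_one]
  have hab2 : a * b * (a * b) = 1 := by
    rw [mul_assoc, ← mul_assoc b, ← hcomm, mul_assoc a, hb2, mul_one, ha2]
  refine ⟨{1, a, b, a * b}, ⟨?_, by simp, ?_, ?_, ?_⟩, ?_⟩
  · simp only [Finset.mem_insert, Finset.mem_singleton]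
    rintro g (rfl | rfl | rfl | rfl)
    · rw [← pauliPair_zero]
      exact pauliPair_mem 0 0
    · exact ha
    · exact hb
    · exact hab
  · have e1 : a * (a * b) = b := by rw [← mul_assoc, ha2, one_mul]
    have e2 : a * b * a = b := by rw [hcomm, mul_assoc, ha2, mul_one]
    have e3 : b * (a * b) = a := by rw [hcomm, ← mul_assoc, hb2, one_mul]
    have e4 : a * b * b = a := by rw [mul_assoc, hb2, mul_one]
    simp only [Finset.mem_insert, Finset.mem_singleton]
    rintro g (rfl | rfl | rfl | rfl) h (rfl | rfl | rfl | rfl) <;>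
      simp [ha2, hb2, hab2, e1, e2, e3, e4, ← hcomm]
  · rw [Finset.card_insert_of_notMem, Finset.card_insert_of_notMem,
      Finset.card_insert_of_notMem, Finset.card_singleton]
    · simpa using n3
    · simpa using ⟨n1, n2⟩
    · simpa using ⟨h1 _ hta, h1 _ htb, h1 _ htab⟩
  · have hne : ∀ m : Matrix (Fin 4) (Fin 4) ℂ, m.trace = 0 → -1 ≠ m := by
      rintro m hm rfl
      rw [trace_neg, ht1] at hm
      norm_num at hm
    have hne1 : (-1 : Matrix (Fin 4) (Fin 4) ℂ) ≠ 1 := by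
      intro h
      have := congrArg Matrix.trace h
      rw [trace_neg, ht1] at this
      norm_num at this
    simp only [Finset.mem_insert, Finset.mem_singleton, not_or]
    exact ⟨hne1, hne _ hta, hne _ htb, hne _ htab⟩
  · rw [Finset.sum_insert, Finset.sum_insert, Finset.sum_insert, Finset.sum_singleton]
    · simp only [add_assoc]
    · simpa using n3
    · simpa using ⟨n1, n2⟩
    · simpa using ⟨h1 _ hta, h1 _ htb, h1 _ htab⟩

lemma pauliPair_XX_mul_ZZ : pauliPair 1 1 * pauliPair 3 3 = -pauliPair 2 2 := by
  rw [pauliPair, pauliPair, pauliPair, kron2_mul, kron2_eq, kron2_eq]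
  ext i j
  fin_cases i <;> fin_cases j <;> simp [pauli, PX, PY, PZ]

lemma pauliPair_ZZ_mul_XX : pauliPair 3 3 * pauliPair 1 1 = -pauliPair 2 2 := by
  rw [pauliPair, pauliPair, pauliPair, kron2_mul, kron2_eq, kron2_eq]
  ext i j
  fin_cases i <;> fin_cases j <;> simp [pauli, PX, PY, PZ]

lemma pauliPair_ZI_mul_IZ : pauliPair 3 0 * pauliPair 0 3 = pauliPair 3 3 := by
  simp [pauliPair, kron2_mul, pauli]

lemma pauliPair_IZ_mul_ZI : pauliPair 0 3 * pauliPair 3 0 = pauliPair 3 3 := by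
  simp [pauliPair, kron2_mul, pauli]

/-- The Bell state `Φ⁺` (for `ε = 1`) or `Φ⁻` (for `ε = -1`). -/
def bellState (ε : ℝ) : Matrix (Fin 4) (Fin 4) ℂ :=
  (4 : ℂ)⁻¹ • (1 + pauliPair 3 3 + ε • (pauliPair 1 1 - pauliPair 2 2))

/-- The basis state `|00⟩` (for `ε = 1`) or `|11⟩` (for `ε = -1`). -/
def basisState (ε : ℝ) : Matrix (Fin 4) (Fin 4) ℂ :=
  (4 : ℂ)⁻¹ • (1 + pauliPair 3 3 + ε • (pauliPair 3 0 + pauliPair 0 3))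

lemma bellState_mem {ε : ℝ} (hε : ε = 1 ∨ ε = -1) : bellState ε ∈ Stab2 := by
  rcases hε with rfl | rfl
  · convert stab2_of_generators (pauliPair_mem 1 1) (pauliPair_mem 3 3) ?_
      (pauliPair_mul_self _ _) (pauliPair_mul_self _ _) ?_ ?_ ?_ ?_ using 1
    · rw [bellState, pauliPair_XX_mul_ZZ, one_smul]
      congr 1
      abel
    · rw [pauliPair_XX_mul_ZZ]
      exact neg_pauliPair_mem 2 2
    · rw [pauliPair_XX_mul_ZZ, pauliPair_ZZ_mul_XX]
    · simp [trace_pauliPair]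
    · simp [trace_pauliPair]
    · simp [trace_pauliPair_mul]
  · convert stab2_of_generators (neg_pauliPair_mem 1 1) (pauliPair_mem 3 3) ?_
      ?_ (pauliPair_mul_self _ _) ?_ ?_ ?_ ?_ using 1
    · rw [bellState, neg_mul, pauliPair_XX_mul_ZZ, neg_one_smul]
      congr 1
      abel
    · rw [neg_mul, pauliPair_XX_mul_ZZ, neg_neg]
      exact pauliPair_mem 2 2
    · rw [neg_mul_neg, pauliPair_mul_self]
    · rw [neg_mul, mul_neg, pauliPair_XX_mul_ZZ, pauliPair_ZZ_mul_XX]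
    · simp [trace_pauliPair]
    · simp [trace_pauliPair]
    · simp [trace_pauliPair_mul]

lemma basisState_mem {ε : ℝ} (hε : ε = 1 ∨ ε = -1) : basisState ε ∈ Stab2 := by
  rcases hε with rfl | rfl
  · convert stab2_of_generators (pauliPair_mem 3 0) (pauliPair_mem 0 3) ?_
      (pauliPair_mul_self _ _) (pauliPair_mul_self _ _) ?_ ?_ ?_ ?_ using 1
    · rw [basisState, pauliPair_ZI_mul_IZ, one_smul]
      congr 1
      abel
    · rw [pauliPair_ZI_mul_IZ]
      exact pauliPair_mem 3 3
    · rw [pauliPair_ZI_mul_IZ, pauliPair_IZ_mul_ZI]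
    · simp [trace_pauliPair]
    · simp [trace_pauliPair]
    · simp [trace_pauliPair_mul]
  · convert stab2_of_generators (neg_pauliPair_mem 3 0) (neg_pauliPair_mem 0 3) ?_
      ?_ ?_ ?_ ?_ ?_ ?_ using 1
    · rw [basisState, neg_mul_neg, pauliPair_ZI_mul_IZ, neg_one_smul]
      congr 1
      abel
    · rw [neg_mul_neg, pauliPair_ZI_mul_IZ]
      exact pauliPair_mem 3 3
    · rw [neg_mul_neg, pauliPair_mul_self]
    · rw [neg_mul_neg, pauliPair_mul_self]
    · rw [neg_mul_neg, neg_mul_neg, pauliPair_ZI_mul_IZ, pauliPair_IZ_mul_ZI]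
    · simp [trace_pauliPair]
    · simp [trace_pauliPair]
    · simp [trace_pauliPair_mul]

/-- The Pauli expansion of the `R_y` family. -/
lemma proj_psiRy (θ : ℝ) : proj (psiRy θ) = (4 : ℂ)⁻¹ • (1 + pauliPair 3 3
    + Real.sin θ • (pauliPair 1 1 - pauliPair 2 2)
    + Real.cos θ • (pauliPair 3 0 + pauliPair 0 3)) := by
  have hs : Real.sin θ = 2 * Real.sin (θ / 2) * Real.cos (θ / 2) := by
    rw [← Real.sin_two_mul]
    ring_nf
  have hc : Real.cos θ = 2 * Real.cos (θ / 2) ^ 2 - 1 := by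
    rw [← Real.cos_two_mul]
    ring_nf
  have hsc : (Real.sin (θ / 2) : ℂ) ^ 2 = 1 - (Real.cos (θ / 2) : ℂ) ^ 2 := by
    exact_mod_cast Real.sin_sq (θ / 2)
  unfold proj psiRy
  rw [hs, hc]
  generalize Real.sin (θ / 2) = s at *
  generalize Real.cos (θ / 2) = c at *
  simp only [pauliPair, kron2_eq]
  ext i j
  fin_cases i <;> fin_cases j <;>
    simp [vecMulVec_apply, pauli, PX, PY, PZ] <;>
    first | ring1 | linear_combination hsc

lemma W2_add (M N : Matrix (Fin 4) (Fin 4) ℂ) : W2 (M + N) = W2 M + W2 N := by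
  ext α
  simp [W2, add_mul, mul_add]

lemma W2_smul (r : ℝ) (M : Matrix (Fin 4) (Fin 4) ℂ) : W2 (r • M) = r • W2 M := by
  ext α
  simp [W2]
  ring

/-- The signs of the Pauli operators in the expansion of a phase-point operator. -/
def phaseSign (a : Fin 4) (x : ZMod 2 × ZMod 2) : ℝ :=
  ![1, (-1) ^ x.2.val, (-1) ^ (x.1.val + x.2.val), (-1) ^ x.1.val] a

lemma phaseSign_cases (x : ZMod 2 × ZMod 2) :
    phaseSign 0 x = 1 ∧ (phaseSign 1 x = 1 ∨ phaseSign 1 x = -1) ∧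
      phaseSign 2 x = phaseSign 1 x * phaseSign 3 x ∧
      (phaseSign 3 x = 1 ∨ phaseSign 3 x = -1) :=
  ⟨rfl, neg_one_pow_eq_or ℝ _, (pow_add _ _ _).trans (mul_comm _ _), neg_one_pow_eq_or ℝ _⟩

lemma trace_pauli_mul_A1 (a : Fin 4) (x : ZMod 2 × ZMod 2) :
    (pauli a * A1 x).trace = phaseSign a x := by
  have h : A1 x = (1 / 2 : ℂ) • ((phaseSign 0 x : ℂ) • pauli 0 + (phaseSign 1 x : ℂ) • pauli 1
      + (phaseSign 2 x : ℂ) • pauli 2 + (phaseSign 3 x : ℂ) • pauli 3) := by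
    simp [A1, phaseSign, pauli]
  rw [h]
  simp only [mul_smul_comm, mul_add, trace_smul, trace_add, trace_pauli_mul]
  fin_cases a <;> simp <;> ring

lemma sum_phaseSign_smul_A1 (a : Fin 4) :
    ∑ x, (phaseSign a x : ℂ) • A1 x = (2 : ℂ) • pauli a := by
  have hu : (Finset.univ : Finset (ZMod 2 × ZMod 2)) = {(0, 0), (0, 1), (1, 0), (1, 1)} := by
    decide
  have hv : (1 : ZMod 2).val = 1 := rfl
  rw [hu, Finset.sum_insert (by decide), Finset.sum_insert (by decide),
    Finset.sum_insert (by decide), Finset.sum_singleton]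
  fin_cases a <;> ext i j <;> fin_cases i <;> fin_cases j <;>
    simp [phaseSign, A1, hv, pauli, PX, PY, PZ] <;> ring

lemma W2_pauliPair (a b : Fin 4) (α : (ZMod 2 × ZMod 2) × (ZMod 2 × ZMod 2)) :
    W2 (pauliPair a b) α = phaseSign a α.1 * phaseSign b α.2 / 4 := by
  rw [W2, A2, pauliPair, kron2_mul, trace_kron2, trace_pauli_mul_A1, trace_pauli_mul_A1]
  norm_cast
  simp
  ring

lemma sum_phaseSign_smul_A2 (a b : Fin 4) :
    ∑ α : (ZMod 2 × ZMod 2) × (ZMod 2 × ZMod 2),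
      ((phaseSign a α.1 * phaseSign b α.2 : ℝ) : ℂ) • A2 α = (4 : ℂ) • pauliPair a b := by
  have h (c : Fin 4) (i j : Fin 2) :
      ∑ x, (phaseSign c x : ℂ) * A1 x i j = 2 * pauli c i j := by
    have := congrFun₂ (sum_phaseSign_smul_A1 c) i j
    simpa [Matrix.sum_apply] using this
  have hk (i j : Fin 4) : ∃ i₁ i₂ j₁ j₂ : Fin 2,
      ∀ M N : Matrix (Fin 2) (Fin 2) ℂ, kron2 M N i j = M i₁ j₁ * N i₂ j₂ :=
    ⟨_, _, _, _, fun _ _ => rfl⟩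
  ext i j
  obtain ⟨i₁, i₂, j₁, j₂, hij⟩ := hk i j
  simp only [Matrix.sum_apply, Matrix.smul_apply, A2, pauliPair, hij, smul_eq_mul]
  have h4 : 4 * (pauli a i₁ j₁ * pauli b i₂ j₂)
      = (2 * pauli a i₁ j₁) * (2 * pauli b i₂ j₂) := by ring
  rw [h4, ← h, ← h, Fintype.sum_mul_sum, Fintype.sum_prod_type]
  refine Finset.sum_congr rfl fun x _ => Finset.sum_congr rfl fun y _ => ?_
  push_cast
  ring

lemma sum_phaseSign_mul_W2 (a b : Fin 4) (σ : Matrix (Fin 4) (Fin 4) ℂ) :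
    ∑ α, phaseSign a α.1 * phaseSign b α.2 * W2 σ α = (σ * pauliPair a b).trace.re := by
  have h : pauliPair a b = (4 : ℂ)⁻¹ • ∑ α : (ZMod 2 × ZMod 2) × (ZMod 2 × ZMod 2),
      ((phaseSign a α.1 * phaseSign b α.2 : ℝ) : ℂ) • A2 α := by
    rw [sum_phaseSign_smul_A2, smul_smul]
    norm_num
  rw [h, mul_smul_comm, trace_smul, Finset.mul_sum, trace_sum, smul_eq_mul, Finset.mul_sum,
    Complex.re_sum]
  refine Finset.sum_congr rfl fun α _ => ?_
  rw [mul_smul_comm, trace_smul, smul_eq_mul, mul_left_comm, Complex.re_ofReal_mul, W2]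

/-- The dual witness for the Wigner distance of the `R_y` family. -/
def wignerWitness (ε : ℝ) (w : (ZMod 2 × ZMod 2) × (ZMod 2 × ZMod 2) → ℝ) : ℝ :=
  ∑ α, (phaseSign 1 α.1 * phaseSign 1 α.2 - phaseSign 2 α.1 * phaseSign 2 α.2
    + ε * (phaseSign 3 α.1 * phaseSign 0 α.2 + phaseSign 0 α.1 * phaseSign 3 α.2)) / 2 * w α

lemma wignerWitness_add (ε : ℝ) (v w : (ZMod 2 × ZMod 2) × (ZMod 2 × ZMod 2) → ℝ) :
    wignerWitness ε (v + w) = wignerWitness ε v + wignerWitness ε w := by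
  simp only [wignerWitness, Pi.add_apply, mul_add, Finset.sum_add_distrib]

lemma wignerWitness_smul (ε r : ℝ) (w : (ZMod 2 × ZMod 2) × (ZMod 2 × ZMod 2) → ℝ) :
    wignerWitness ε (r • w) = r * wignerWitness ε w := by
  simp only [wignerWitness, Pi.smul_apply, smul_eq_mul, Finset.mul_sum]
  exact Finset.sum_congr rfl fun α _ => by ring

lemma wignerWitness_W2 (ε : ℝ) (σ : Matrix (Fin 4) (Fin 4) ℂ) :
    wignerWitness ε (W2 σ) = ((σ * pauliPair 1 1).trace.re - (σ * pauliPair 2 2).trace.re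
      + ε * ((σ * pauliPair 3 0).trace.re + (σ * pauliPair 0 3).trace.re)) / 2 := by
  simp only [← sum_phaseSign_mul_W2, ← Finset.sum_sub_distrib, ← Finset.sum_add_distrib,
    Finset.mul_sum, Finset.sum_div, wignerWitness]
  exact Finset.sum_congr rfl fun α _ => by ring

lemma wignerWitness_le_sum_abs {ε : ℝ} (hε : ε = 1 ∨ ε = -1)
    (w : (ZMod 2 × ZMod 2) × (ZMod 2 × ZMod 2) → ℝ) : wignerWitness ε w ≤ ∑ α, |w α| := by
  refine Finset.sum_le_sum fun α _ => (le_abs_self _).trans ?_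
  rw [abs_mul]
  refine mul_le_of_le_one_left (abs_nonneg _) ?_
  obtain ⟨h0, h1, h2, h3⟩ := phaseSign_cases α.1
  obtain ⟨k0, k1, k2, k3⟩ := phaseSign_cases α.2
  rw [h2, k2, h0, k0]
  rcases hε with rfl | rfl <;> rcases h1 with h1 | h1 <;> rcases h3 with h3 | h3 <;>
    rcases k1 with k1 | k1 <;> rcases k3 with k3 | k3 <;> rw [h1, h3, k1, k3] <;> norm_num

lemma pauliPair_XX_anticomm_ZI :
    pauliPair 1 1 * pauliPair 3 0 = -(pauliPair 3 0 * pauliPair 1 1) := by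
  simp only [pauliPair, kron2_eq]
  ext i j
  fin_cases i <;> fin_cases j <;> simp [pauli, PX, PZ]

lemma pauliPair_YY_anticomm_IZ :
    pauliPair 2 2 * pauliPair 0 3 = -(pauliPair 0 3 * pauliPair 2 2) := by
  simp only [pauliPair, kron2_eq]
  ext i j
  fin_cases i <;> fin_cases j <;> simp [pauli, PY, PZ]

lemma abs_eq_one_of_sign {ε : ℝ} (hε : ε = 1 ∨ ε = -1) : |ε| = 1 := by
  rcases hε with rfl | rfl <;> simp

lemma wignerWitness_le_one {ε : ℝ} (hε : ε = 1 ∨ ε = -1)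
    {f : (ZMod 2 × ZMod 2) × (ZMod 2 × ZMod 2) → ℝ} (hf : f ∈ WFree2) :
    wignerWitness ε f ≤ 1 := by
  have hconv : Convex ℝ {f | wignerWitness ε f ≤ 1} :=
    convex_halfSpace_le ⟨wignerWitness_add ε, wignerWitness_smul ε⟩ 1
  refine convexHull_min ?_ hconv hf
  rintro _ ⟨σ, hσ, rfl⟩
  have h1 := stab2_abs_add_abs_le hσ 1 1 3 0 pauliPair_XX_anticomm_ZI
  have h2 := stab2_abs_add_abs_le hσ 2 2 0 3 pauliPair_YY_anticomm_IZ
  have hmul (x : ℝ) : ε * x ≤ |x| := by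
    simpa [abs_mul, abs_eq_one_of_sign hε] using le_abs_self (ε * x)
  rw [Set.mem_ofPred_eq, wignerWitness_W2]
  linarith [le_abs_self (σ * pauliPair 1 1).trace.re, neg_abs_le (σ * pauliPair 2 2).trace.re,
    hmul (σ * pauliPair 3 0).trace.re, hmul (σ * pauliPair 0 3).trace.re]

lemma trace_proj_psiRy_mul (θ : ℝ) :
    (proj (psiRy θ) * pauliPair 1 1).trace.re = Real.sin θ ∧
      (proj (psiRy θ) * pauliPair 2 2).trace.re = -Real.sin θ ∧
      (proj (psiRy θ) * pauliPair 3 0).trace.re = Real.cos θ ∧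
      (proj (psiRy θ) * pauliPair 0 3).trace.re = Real.cos θ := by
  rw [proj_psiRy, ← pauliPair_zero]
  simp only [smul_mul_assoc, add_mul, sub_mul, trace_smul, trace_add, trace_sub,
    trace_pauliPair_mul]
  simp [-Complex.ofReal_sin, -Complex.ofReal_cos]
  constructor <;> ring

lemma sum_abs_W2_ZI_add_IZ : ∑ α, |W2 (pauliPair 3 0 + pauliPair 0 3) α| = 4 := by
  have h (α : (ZMod 2 × ZMod 2) × (ZMod 2 × ZMod 2)) :
      |W2 (pauliPair 3 0 + pauliPair 0 3) α|
        = phaseSign 0 α.1 * phaseSign 0 α.2 * W2 (pauliPair 0 0 + pauliPair 3 3) α := by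
    rw [W2_add, W2_add, Pi.add_apply, Pi.add_apply]
    simp only [W2_pauliPair]
    obtain ⟨h0, -, -, h3⟩ := phaseSign_cases α.1
    obtain ⟨k0, -, -, k3⟩ := phaseSign_cases α.2
    rw [h0, k0]
    rcases h3 with h3 | h3 <;> rcases k3 with k3 | k3 <;> rw [h3, k3] <;> norm_num
  simp_rw [h]
  rw [sum_phaseSign_mul_W2, add_mul, trace_add, trace_pauliPair_mul, trace_pauliPair_mul]
  simp

lemma exists_sign_mul_eq_abs (x : ℝ) : ∃ ε : ℝ, (ε = 1 ∨ ε = -1) ∧ ε * x = |x| ∧ x = ε * |x| := by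
  rcases abs_choice x with h | h
  · exact ⟨1, Or.inl rfl, by rw [h, one_mul], by rw [h, one_mul]⟩
  · exact ⟨-1, Or.inr rfl, by rw [h, neg_one_mul], by rw [h, neg_one_mul, neg_neg]⟩

lemma one_le_sin_add_abs_cos {θ : ℝ} (hs : 0 ≤ Real.sin θ) :
    1 ≤ Real.sin θ + |Real.cos θ| := by
  nlinarith [Real.sin_sq_add_cos_sq θ, sq_abs (Real.cos θ), abs_nonneg (Real.cos θ),
    mul_nonneg hs (abs_nonneg (Real.cos θ))]

lemma C2_proj_psiRy {θ : ℝ} (hs : 0 ≤ Real.sin θ) :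
    C2 (proj (psiRy θ)) = Real.sin θ + |Real.cos θ| - 1 := by
  obtain ⟨ε, hε, hεc, hc⟩ := exists_sign_mul_eq_abs (Real.cos θ)
  have hsc := one_le_sin_add_abs_cos hs
  obtain ⟨t1, t2, t3, t4⟩ := trace_proj_psiRy_mul θ
  refine IsLeast.csInf_eq ⟨?_, ?_⟩
  · refine ⟨Real.sin θ • W2 (bellState 1) + (1 - Real.sin θ) • W2 (basisState ε), ?_, ?_⟩
    · have hmem {σ : Matrix (Fin 4) (Fin 4) ℂ} (hσ : σ ∈ Stab2) : W2 σ ∈ WFree2 :=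
        subset_convexHull ℝ _ ⟨σ, hσ, rfl⟩
      exact convex_convexHull ℝ _ (hmem (bellState_mem (Or.inl rfl))) (hmem (basisState_mem hε))
        hs (sub_nonneg.mpr (Real.sin_le_one θ)) (by ring)
    · have hρ : proj (psiRy θ) = Real.sin θ • bellState 1 + (1 - Real.sin θ) • basisState ε
          + ((Real.sin θ + |Real.cos θ| - 1) * ε / 4) • (pauliPair 3 0 + pauliPair 0 3) := by
        rw [proj_psiRy, bellState, basisState, hc]
        rw [abs_mul, abs_eq_one_of_sign hε, one_mul, abs_abs]
        ext i j
        simp [-Complex.ofReal_sin, -Complex.ofReal_cos]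
        ring
      have hsum (α : (ZMod 2 × ZMod 2) × (ZMod 2 × ZMod 2)) :
          |W2 (proj (psiRy θ)) α
            - (Real.sin θ • W2 (bellState 1) + (1 - Real.sin θ) • W2 (basisState ε)) α|
          = (Real.sin θ + |Real.cos θ| - 1) / 4 * |W2 (pauliPair 3 0 + pauliPair 0 3) α| := by
        rw [hρ, W2_add _ ((_ : ℝ) • _), W2_add (_ • _), W2_smul, W2_smul, W2_smul, Pi.add_apply,
          add_sub_cancel_left, Pi.smul_apply, smul_eq_mul, abs_mul, abs_div, abs_mul,
          abs_eq_one_of_sign hε, abs_of_nonneg (sub_nonneg.mpr hsc), mul_one,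
          abs_of_pos (four_pos : (0 : ℝ) < 4)]
      simp_rw [hsum]
      rw [← Finset.mul_sum, sum_abs_W2_ZI_add_IZ]
      ring
  · rintro _ ⟨f, hf, rfl⟩
    have h1 := wignerWitness_le_sum_abs hε (W2 (proj (psiRy θ)) + (-1 : ℝ) • f)
    rw [wignerWitness_add, wignerWitness_smul, wignerWitness_W2, t1, t2, t3, t4] at h1
    simp only [Pi.add_apply, Pi.smul_apply, smul_eq_mul, neg_one_mul, ← sub_eq_add_neg] at h1
    linarith [wignerWitness_le_one hε hf]

lemma Gam2_proj_psiRy {θ : ℝ} (hs : 0 ≤ Real.sin θ) :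
    Gam2 (proj (psiRy θ)) = Real.sin θ + |Real.cos θ| := by
  obtain ⟨ε, hε, hεc, hc⟩ := exists_sign_mul_eq_abs (Real.cos θ)
  have hsc := one_le_sin_add_abs_cos hs
  have hc1 := Real.abs_cos_le_one θ
  obtain ⟨t1, -, t3, -⟩ := trace_proj_psiRy_mul θ
  refine IsLeast.csInf_eq ⟨?_, ?_⟩
  · refine ⟨3, ![(1 + Real.sin θ - |Real.cos θ|) / 2, (1 - Real.sin θ - |Real.cos θ|) / 2,
      |Real.cos θ|], ![bellState 1, bellState (-1), basisState ε], ?_, ?_, ?_⟩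
    · intro i
      fin_cases i
      · exact bellState_mem (Or.inl rfl)
      · exact bellState_mem (Or.inr rfl)
      · exact basisState_mem hε
    · simp only [Fin.sum_univ_three, Matrix.cons_val]
      rw [proj_psiRy, bellState, bellState, basisState, hc]
      rw [abs_mul, abs_eq_one_of_sign hε, one_mul, abs_abs]
      ext i j
      simp [-Complex.ofReal_sin, -Complex.ofReal_cos]
      ring
    · simp only [Fin.sum_univ_three, Matrix.cons_val]
      rw [abs_abs, abs_of_nonneg (a := (1 + Real.sin θ - |Real.cos θ|) / 2) (by linarith),
        abs_of_nonpos (a := (1 - Real.sin θ - |Real.cos θ|) / 2) (by linarith)]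
      ring
  · rintro _ ⟨k, a, s, hmem, hρ, rfl⟩
    have hval : Real.sin θ + |Real.cos θ|
        = ∑ i, a i * ((s i * pauliPair 1 1).trace.re + ε * (s i * pauliPair 3 0).trace.re) := by
      rw [← hεc, ← t3]
      nth_rw 1 [← t1]
      rw [hρ]
      simp only [Finset.sum_mul, trace_sum, Complex.re_sum, smul_mul_assoc, trace_smul,
        Complex.smul_re, smul_eq_mul, Finset.mul_sum, ← Finset.sum_add_distrib]
      exact Finset.sum_congr rfl fun i _ => by ring
    rw [hval]
    refine Finset.sum_le_sum fun i _ => (le_abs_self _).trans ?_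
    rw [abs_mul]
    refine mul_le_of_le_one_right (abs_nonneg _) ((abs_add_le _ _).trans ?_)
    rw [abs_mul, abs_eq_one_of_sign hε, one_mul]
    exact stab2_abs_add_abs_le (hmem i) 1 1 3 0 pauliPair_XX_anticomm_ZI

/-- exact values for the R_y family:
`C = |sin θ| + |cos θ| − 1`, `Γ = |sin θ| + |cos θ|`, hence `κ = 1`. -/
theorem kappa_Ry (θ : ℝ) (h0 : 0 < θ) (hπ : θ < Real.pi) :
    C2 (proj (psiRy θ)) = |Real.sin θ| + |Real.cos θ| - 1 ∧
    Gam2 (proj (psiRy θ)) = |Real.sin θ| + |Real.cos θ| ∧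
    Gam2 (proj (psiRy θ)) - 1 = C2 (proj (psiRy θ)) ∧
    (0 < C2 (proj (psiRy θ)) →
      (Gam2 (proj (psiRy θ)) - 1) / C2 (proj (psiRy θ)) = 1) := by
  have hs : 0 ≤ Real.sin θ := (Real.sin_pos_of_pos_of_lt_pi h0 hπ).le
  rw [C2_proj_psiRy hs, Gam2_proj_psiRy hs, abs_of_nonneg hs]
  exact ⟨rfl, rfl, rfl, fun h => div_self h.ne'⟩
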